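/- arXiv:2605.00298 — 2 statements merged into one kernel-verified Lean document; each statement's English description precedes it below -/
import Mathlib

section
/- Fix i ∈ {1,…,N} and suppose w_i : [0,1] → ℝ^d is differentiable with ∇F_{S,t,i}(w_i(t)) = 0 for every t ∈ [0,1]. Then for every t ∈ [0,1], ‖w_i'(t)‖ ≤ G/α. -/
open scoped RealInnerProductSpace BigOperators

/-- The Hessian of `f : ℝ^d → ℝ` at `w`, viewed as a continuous linear map on `ℝ^d`,
obtained as the Fréchet derivative of the gradient map. -/
noncomputable def hessian {d : ℕ} (f : EuclideanSpace ℝ (Fin d) → ℝ)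
    (w : EuclideanSpace ℝ (Fin d)) :
    EuclideanSpace ℝ (Fin d) →L[ℝ] EuclideanSpace ℝ (Fin d) :=
  fderiv ℝ (gradient f) w

/-- The regularized empirical risk `F_S(w) = ∑ i, ℓ_i(w) + λ · Reg(w)`. -/
noncomputable def FS {d N : ℕ} (l : Fin N → EuclideanSpace ℝ (Fin d) → ℝ)
    (Reg : EuclideanSpace ℝ (Fin d) → ℝ) (lam : ℝ)
    (w : EuclideanSpace ℝ (Fin d)) : ℝ :=
  (∑ i, l i w) + lam * Reg w

/-- The deletion-path objective `F_{S,t,i}(w) = F_S(w) − t · ℓ_i(w)`. -/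
noncomputable def FSt {d N : ℕ} (l : Fin N → EuclideanSpace ℝ (Fin d) → ℝ)
    (Reg : EuclideanSpace ℝ (Fin d) → ℝ) (lam : ℝ) (i : Fin N) (t : ℝ)
    (w : EuclideanSpace ℝ (Fin d)) : ℝ :=
  FS l Reg lam w - t * l i w

theorem contDiff_grad_aux {d : ℕ} {f : EuclideanSpace ℝ (Fin d) → ℝ} (hf : ContDiff ℝ 2 f) :
    Differentiable ℝ (gradient f) := by
  have h1 : ContDiff ℝ 1 (fderiv ℝ f) := hf.fderiv_right (by norm_num)
  have h2 : Differentiable ℝ (fderiv ℝ f) := h1.differentiable (by norm_num)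
  exact ((InnerProductSpace.toDual ℝ (EuclideanSpace ℝ (Fin d))).symm.toContinuousLinearEquiv.differentiable).comp h2

theorem contDiff_FS_aux {d N : ℕ} {l : Fin N → EuclideanSpace ℝ (Fin d) → ℝ}
    {Reg : EuclideanSpace ℝ (Fin d) → ℝ} {lam : ℝ} (hl : ∀ i, ContDiff ℝ 2 (l i))
    (hReg : ContDiff ℝ 2 Reg) : ContDiff ℝ 2 (FS l Reg lam) := by
  unfold FS
  exact (ContDiff.sum fun i _ => hl i).add (contDiff_const.mul hReg)

theorem grad_FSt_aux {d N : ℕ} {l : Fin N → EuclideanSpace ℝ (Fin d) → ℝ}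
    {Reg : EuclideanSpace ℝ (Fin d) → ℝ} {lam : ℝ} (hl : ∀ i, ContDiff ℝ 2 (l i))
    (hReg : ContDiff ℝ 2 Reg) (i : Fin N) (t : ℝ) :
    gradient (FSt l Reg lam i t) =
      fun x => gradient (FS l Reg lam) x - t • gradient (l i) x := by
  funext x
  have h1 : DifferentiableAt ℝ (FS l Reg lam) x :=
    (contDiff_FS_aux hl hReg).differentiable (by norm_num) x
  have h2 : DifferentiableAt ℝ (l i) x := (hl i).differentiable (by norm_num) x
  have h : HasFDerivAt (FSt l Reg lam i t)
      (fderiv ℝ (FS l Reg lam) x - t • fderiv ℝ (l i) x) x :=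
    h1.hasFDerivAt.sub (h2.hasFDerivAt.const_mul t)
  unfold gradient
  rw [h.fderiv]
  simp

/-- along the deletion path, `‖w_i'(t)‖ ≤ G/α`. -/
theorem stmt2 {d N : ℕ} (hd : 1 ≤ d) (hN : 1 ≤ N)
    (l : Fin N → EuclideanSpace ℝ (Fin d) → ℝ)
    (Reg : EuclideanSpace ℝ (Fin d) → ℝ)
    (lam G H α : ℝ) (hlam : 0 < lam) (hα : 0 < α)
    -- (A1) smooth losses
    (hl : ∀ i, ContDiff ℝ 2 (l i))
    (hlG : ∀ i w, ‖gradient (l i) w‖ ≤ G)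
    (hlH : ∀ i w, ‖hessian (l i) w‖ ≤ H)
    -- (A2) smooth regularizer
    (hReg : ContDiff ℝ 2 Reg)
    -- (A3) strong convexity of every F_{S,t,i}
    (hSC : ∀ (i : Fin N) (t : ℝ), t ∈ Set.Icc (0 : ℝ) 1 →
      ∀ w v : EuclideanSpace ℝ (Fin d),
        α * ‖v‖ ^ 2 ≤ ⟪hessian (FSt l Reg lam i t) w v, v⟫)
    -- the curve and its derivative, with first-order optimality along the path
    (i : Fin N) (w w' : ℝ → EuclideanSpace ℝ (Fin d))
    (hw : ∀ t ∈ Set.Icc (0 : ℝ) 1, HasDerivWithinAt w (w' t) (Set.Icc (0 : ℝ) 1) t)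
    (hopt : ∀ t ∈ Set.Icc (0 : ℝ) 1, gradient (FSt l Reg lam i t) (w t) = 0) :
    ∀ t ∈ Set.Icc (0 : ℝ) 1, ‖w' t‖ ≤ G / α := by
  intro t ht
  have dF := contDiff_grad_aux (contDiff_FS_aux (lam := lam) hl hReg)
  have dl := contDiff_grad_aux (hl i)
  have hF := (dF (w t)).hasFDerivAt.comp_hasDerivWithinAt t (hw t ht)
  have hL := (dl (w t)).hasFDerivAt.comp_hasDerivWithinAt t (hw t ht)
  have hD := hF.sub ((hasDerivWithinAt_id t (Set.Icc (0:ℝ) 1)).smul hL)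
  have hZ : HasDerivWithinAt (fun _ : ℝ => (0 : EuclideanSpace ℝ (Fin d))) 0
      (Set.Icc (0:ℝ) 1) t := hasDerivWithinAt_const _ _ _
  have hD' := hZ.congr (f₁ := fun s => gradient (FS l Reg lam) (w s) - s • gradient (l i) (w s))
    (fun s hs => by
      have := hopt s hs
      rw [grad_FSt_aux hl hReg] at this
      simpa using this)
    (by
      have := hopt t ht
      rw [grad_FSt_aux hl hReg] at this
      simpa using this)
  have hE := UniqueDiffWithinAt.eq_deriv _ (uniqueDiffOn_Icc (zero_lt_one (α := ℝ)) t ht) hD hD'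
  have hH : hessian (FSt l Reg lam i t) (w t) (w' t) = gradient (l i) (w t) := by
    unfold hessian
    rw [grad_FSt_aux hl hReg]
    have h := (dF (w t)).hasFDerivAt.sub ((dl (w t)).hasFDerivAt.const_smul t)
    have h' : fderiv ℝ (fun x => gradient (FS l Reg lam) x - t • gradient (l i) x) (w t) = _ :=
      h.fderiv
    rw [h']
    simp at hE ⊢
    rw [← sub_eq_zero, ← hE]
    abel
  have h1 := hSC i t ht (w t) (w' t)
  rw [hH] at h1
  have h2 := real_inner_le_norm (gradient (l i) (w t)) (w' t)
  have h3 := mul_le_mul_of_nonneg_right (hlG i (w t)) (norm_nonneg (w' t))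
  have hG : 0 ≤ G := (norm_nonneg _).trans (hlG i (w t))
  rw [le_div_iff₀ hα]
  rcases (norm_nonneg (w' t)).eq_or_lt with h0 | h0
  · rw [← h0]; simpa using hG
  · have : (‖w' t‖ * α) * ‖w' t‖ ≤ G * ‖w' t‖ := by nlinarith
    exact le_of_mul_le_mul_right this h0
end

section
/- (Beneficial deletion.) Suppose for each i ∈ {1,…,N} there is a twice continuously differentiable curve w_i : [0,1] → ℝ^d with ∇F_{S,t,i}(w_i(t)) = 0 for every t ∈ [0,1], with w_i(0) = ŵ the global minimizer of F_S and w_i(1) = ŵ_{-i} the global minimizer of F_{S,-i}. Define H₀ := ∇²F_S(ŵ), D := ⟨∇L(ŵ), H₀⁻¹( −(1/λ)·Σ_{i=1}^N ∇ℓ_i(ŵ) )⟩, β̄ := N·β + λ·β_R, and C := 3HG²/α² + β̄G³/α³. If λ·D > C·N/2, then deleting a uniformly chosen training example strictly decreases the expected test loss: (1/N)·Σ_{i=1}^N L(ŵ_{-i}) < L(ŵ). -/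
open scoped RealInnerProductSpace BigOperators

theorem aux_taylor (f f' f'' : ℝ → ℝ) (C : ℝ)
    (h1 : ∀ t ∈ Set.Icc (0 : ℝ) 1, HasDerivWithinAt f (f' t) (Set.Icc (0 : ℝ) 1) t)
    (h2 : ∀ t ∈ Set.Icc (0 : ℝ) 1, HasDerivWithinAt f' (f'' t) (Set.Icc (0 : ℝ) 1) t)
    (hC : ∀ t ∈ Set.Icc (0 : ℝ) 1, f'' t ≤ C) :
    f 1 ≤ f 0 + f' 0 + C / 2 := by
  have conv : ∀ (g : ℝ → ℝ) (a : ℝ), ∀ t ∈ Set.Ico (0 : ℝ) 1,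
      HasDerivWithinAt g a (Set.Icc (0 : ℝ) 1) t → HasDerivWithinAt g a (Set.Ici t) t := by
    intro g a t ht h
    have : HasDerivWithinAt g a (Set.Icc t 1) t := h.mono (Set.Icc_subset_Icc_left ht.1)
    exact this.mono_of_mem_nhdsWithin (Icc_mem_nhdsGE ht.2)
  have b1 : ∀ t ∈ Set.Icc (0 : ℝ) 1, f' t ≤ f' 0 + C * t := by
    intro t ht
    refine image_le_of_deriv_right_le_deriv_boundary (f := f') (f' := f'') (a := 0) (b := 1)
      (B := fun t => f' 0 + C * t) (B' := fun _ => C)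
      (fun x hx => (h2 x hx).continuousWithinAt)
      (fun x hx => conv _ _ x hx (h2 x (Set.Ico_subset_Icc_self hx))) (by simp)
      (by fun_prop) ?_ (fun x hx => hC x (Set.Ico_subset_Icc_self hx)) ht
    intro x hx
    have := ((hasDerivAt_id x).const_mul C).const_add (f' 0)
    simpa using this.hasDerivWithinAt
  have b2 := image_le_of_deriv_right_le_deriv_boundary (f := f) (f' := f') (a := 0) (b := 1)
      (B := fun t => f 0 + (f' 0 * t + C / 2 * t ^ 2)) (B' := fun t => f' 0 + C * t)
      (fun x hx => (h1 x hx).continuousWithinAt)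
      (fun x hx => conv _ _ x hx (h1 x (Set.Ico_subset_Icc_self hx))) (by simp)
      (by fun_prop) (by
        intro x hx
        have := ((((hasDerivAt_id x).const_mul (f' 0)).add
          (((hasDerivAt_id x).pow 2).const_mul (C / 2))).const_add (f 0))
        refine (this.congr_deriv ?_).hasDerivWithinAt
        simp
        ring) (fun x hx => b1 x (Set.Ico_subset_Icc_self hx))
      (x := 1) (by simp)
  simp only [mul_one, one_pow] at b2
  linarith

theorem aux_grad_contDiff {d : ℕ} {f : EuclideanSpace ℝ (Fin d) → ℝ} {m n : ℕ}
    (hf : ContDiff ℝ n f) (h : m + 1 ≤ n) : ContDiff ℝ m (gradient f) := by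
  have h1 : ContDiff ℝ m (fderiv ℝ f) := hf.fderiv_right (by exact_mod_cast h)
  exact ((InnerProductSpace.toDual ℝ (EuclideanSpace ℝ (Fin d))).symm.toContinuousLinearEquiv.contDiff).comp h1

theorem aux_hess_contDiff {d : ℕ} {f : EuclideanSpace ℝ (Fin d) → ℝ} {m n : ℕ}
    (hf : ContDiff ℝ n f) (h : m + 2 ≤ n) : ContDiff ℝ m (hessian f) := by
  have h1 : ContDiff ℝ ((m + 1 : ℕ)) (gradient f) := aux_grad_contDiff hf (by omega)
  exact h1.fderiv_right (by norm_cast)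

theorem aux_grad_FS {d N : ℕ} (l : Fin N → EuclideanSpace ℝ (Fin d) → ℝ)
    (Reg : EuclideanSpace ℝ (Fin d) → ℝ) (lam : ℝ)
    (hl : ∀ i, ContDiff ℝ 3 (l i)) (hReg : ContDiff ℝ 3 Reg) :
    gradient (FS l Reg lam) = fun w => (∑ i, gradient (l i) w) + lam • gradient Reg w := by
  funext w
  have dl : ∀ i, DifferentiableAt ℝ (l i) w := fun i => (hl i).differentiable (by norm_num) w
  have dR : DifferentiableAt ℝ Reg w := hReg.differentiable (by norm_num) w
  have : HasFDerivAt (FS l Reg lam) ((∑ i, fderiv ℝ (l i) w) + lam • fderiv ℝ Reg w) w := by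
    have h1 := HasFDerivAt.fun_sum (u := Finset.univ) (fun i _ => (dl i).hasFDerivAt)
    exact h1.add (dR.hasFDerivAt.const_mul lam)
  simp [gradient, this.fderiv]

theorem aux_hess_FS {d N : ℕ} (l : Fin N → EuclideanSpace ℝ (Fin d) → ℝ)
    (Reg : EuclideanSpace ℝ (Fin d) → ℝ) (lam : ℝ)
    (hl : ∀ i, ContDiff ℝ 3 (l i)) (hReg : ContDiff ℝ 3 Reg) :
    hessian (FS l Reg lam) = fun w => (∑ i, hessian (l i) w) + lam • hessian Reg w := by
  funext w
  have dl : ∀ i, DifferentiableAt ℝ (gradient (l i)) w := fun i =>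
    (aux_grad_contDiff (m := 1) (n := 3) (hl i) (by norm_num)).differentiable (by norm_num) w
  have dR : DifferentiableAt ℝ (gradient Reg) w :=
    (aux_grad_contDiff (m := 1) (n := 3) hReg (by norm_num)).differentiable (by norm_num) w
  unfold hessian
  rw [aux_grad_FS l Reg lam hl hReg]
  have h1 := HasFDerivAt.fun_sum (u := Finset.univ) (fun i _ => (dl i).hasFDerivAt)
  exact (h1.add (dR.hasFDerivAt.const_smul lam)).fderiv

theorem aux_FS_contDiff {d N : ℕ} (l : Fin N → EuclideanSpace ℝ (Fin d) → ℝ)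
    (Reg : EuclideanSpace ℝ (Fin d) → ℝ) (lam : ℝ)
    (hl : ∀ i, ContDiff ℝ 3 (l i)) (hReg : ContDiff ℝ 3 Reg) :
    ContDiff ℝ 3 (FS l Reg lam) := by
  unfold FS
  exact (ContDiff.sum (fun i _ => hl i)).add (contDiff_const.mul hReg)

theorem aux_grad_FSt {d N : ℕ} (l : Fin N → EuclideanSpace ℝ (Fin d) → ℝ)
    (Reg : EuclideanSpace ℝ (Fin d) → ℝ) (lam : ℝ)
    (hl : ∀ i, ContDiff ℝ 3 (l i)) (hReg : ContDiff ℝ 3 Reg) (i : Fin N) (t : ℝ) :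
    gradient (FSt l Reg lam i t) =
      fun w => gradient (FS l Reg lam) w - t • gradient (l i) w := by
  funext w
  have dl : DifferentiableAt ℝ (l i) w := (hl i).differentiable (by norm_num) w
  have dR : DifferentiableAt ℝ (FS l Reg lam) w :=
    (aux_FS_contDiff l Reg lam hl hReg).differentiable (by norm_num) w
  have : HasFDerivAt (FSt l Reg lam i t) (fderiv ℝ (FS l Reg lam) w - t • fderiv ℝ (l i) w) w :=
    dR.hasFDerivAt.sub (dl.hasFDerivAt.const_mul t)
  simp [gradient, this.fderiv]

theorem aux_hess_FSt {d N : ℕ} (l : Fin N → EuclideanSpace ℝ (Fin d) → ℝ)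
    (Reg : EuclideanSpace ℝ (Fin d) → ℝ) (lam : ℝ)
    (hl : ∀ i, ContDiff ℝ 3 (l i)) (hReg : ContDiff ℝ 3 Reg) (i : Fin N) (t : ℝ) :
    hessian (FSt l Reg lam i t) =
      fun w => hessian (FS l Reg lam) w - t • hessian (l i) w := by
  funext w
  have dl : DifferentiableAt ℝ (gradient (l i)) w :=
    (aux_grad_contDiff (m := 1) (n := 3) (hl i) (by norm_num)).differentiable (by norm_num) w
  have dR : DifferentiableAt ℝ (gradient (FS l Reg lam)) w :=
    (aux_grad_contDiff (m := 1) (n := 3) (aux_FS_contDiff l Reg lam hl hReg)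
      (by norm_num)).differentiable (by norm_num) w
  unfold hessian
  rw [aux_grad_FSt l Reg lam hl hReg]
  exact (dR.hasFDerivAt.sub (dl.hasFDerivAt.const_smul t)).fderiv

/-- Lipschitz constant of the Hessian of the path objective. -/
theorem aux_lip {d N : ℕ} (l : Fin N → EuclideanSpace ℝ (Fin d) → ℝ)
    (Reg : EuclideanSpace ℝ (Fin d) → ℝ) (lam β βR : ℝ) (hlam : 0 < lam)
    (hl : ∀ i, ContDiff ℝ 3 (l i)) (hReg : ContDiff ℝ 3 Reg)
    (hlLip : ∀ i w v, ‖hessian (l i) w - hessian (l i) v‖ ≤ β * ‖w - v‖)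
    (hRegLip : ∀ w v, ‖hessian Reg w - hessian Reg v‖ ≤ βR * ‖w - v‖)
    (i : Fin N) (t : ℝ) (ht : t ∈ Set.Icc (0 : ℝ) 1) (w v : EuclideanSpace ℝ (Fin d)) :
    ‖hessian (FSt l Reg lam i t) w - hessian (FSt l Reg lam i t) v‖
      ≤ ((N : ℝ) * β + lam * βR) * ‖w - v‖ := by
  rw [aux_hess_FSt l Reg lam hl hReg, aux_hess_FS l Reg lam hl hReg]
  have e : ((∑ j, hessian (l j) w) + lam • hessian Reg w - t • hessian (l i) w)
      - ((∑ j, hessian (l j) v) + lam • hessian Reg v - t • hessian (l i) v)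
      = (∑ j ∈ Finset.univ.erase i, (hessian (l j) w - hessian (l j) v))
        + (1 - t) • (hessian (l i) w - hessian (l i) v)
        + lam • (hessian Reg w - hessian Reg v) := by
    rw [← Finset.add_sum_erase _ (fun j => hessian (l j) w) (Finset.mem_univ i),
      ← Finset.add_sum_erase _ (fun j => hessian (l j) v) (Finset.mem_univ i),
      Finset.sum_sub_distrib]
    module
  simp only
  rw [e]
  have hN : 1 ≤ N := by have := i.2; omega
  have s1 : ‖∑ j ∈ Finset.univ.erase i, (hessian (l j) w - hessian (l j) v)‖
      ≤ ((N : ℝ) - 1) * (β * ‖w - v‖) := by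
    refine (norm_sum_le_of_le _ (fun j _ => hlLip j w v)).trans (le_of_eq ?_)
    simp [Finset.card_erase_of_mem, Nat.cast_sub hN]
  have s2 : ‖(1 - t) • (hessian (l i) w - hessian (l i) v)‖ ≤ β * ‖w - v‖ := by
    rw [norm_smul, Real.norm_of_nonneg (by linarith [ht.2])]
    have := hlLip i w v
    have h0 := norm_nonneg (hessian (l i) w - hessian (l i) v)
    nlinarith [ht.1]
  have s3 : ‖lam • (hessian Reg w - hessian Reg v)‖ ≤ lam * (βR * ‖w - v‖) := by
    rw [norm_smul, Real.norm_of_nonneg hlam.le]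
    exact mul_le_mul_of_nonneg_left (hRegLip w v) hlam.le
  refine (norm_add₃_le).trans ?_
  linarith

theorem aux_coer {d : ℕ} (A : EuclideanSpace ℝ (Fin d) →L[ℝ] EuclideanSpace ℝ (Fin d)) (α : ℝ)
    (h : ∀ v, α * ‖v‖ ^ 2 ≤ ⟪A v, v⟫) (v : EuclideanSpace ℝ (Fin d)) : α * ‖v‖ ≤ ‖A v‖ := by
  have h1 := (h v).trans (real_inner_le_norm _ _)
  rcases (norm_nonneg v).eq_or_lt with h0 | h0
  · rw [← h0]; simp
  · nlinarith

theorem aux_unit {d : ℕ} (A : EuclideanSpace ℝ (Fin d) →L[ℝ] EuclideanSpace ℝ (Fin d)) (α : ℝ)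
    (hα : 0 < α) (h : ∀ v, α * ‖v‖ ≤ ‖A v‖) : IsUnit A := by
  have inj : Function.Injective A := by
    rw [injective_iff_map_eq_zero]
    intro v hv
    have := h v
    rw [hv, norm_zero] at this
    exact norm_le_zero_iff.mp (by nlinarith)
  rw [ContinuousLinearMap.isUnit_iff_bijective]
  exact ⟨inj, (LinearMap.injective_iff_surjective (f := A.toLinearMap)).mp inj⟩

/-- One curve. -/
theorem aux_curve {d N : ℕ} (hd : 1 ≤ d)
    (l : Fin N → EuclideanSpace ℝ (Fin d) → ℝ)
    (Reg : EuclideanSpace ℝ (Fin d) → ℝ)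
    (L : EuclideanSpace ℝ (Fin d) → ℝ)
    (lam G H β βR α : ℝ) (hlam : 0 < lam) (hα : 0 < α)
    (hl : ∀ i, ContDiff ℝ 3 (l i))
    (hlG : ∀ i w, ‖gradient (l i) w‖ ≤ G)
    (hlH : ∀ i w, ‖hessian (l i) w‖ ≤ H)
    (hlLip : ∀ i w v, ‖hessian (l i) w - hessian (l i) v‖ ≤ β * ‖w - v‖)
    (hReg : ContDiff ℝ 3 Reg)
    (hRegLip : ∀ w v, ‖hessian Reg w - hessian Reg v‖ ≤ βR * ‖w - v‖)
    (hL : ContDiff ℝ 2 L)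
    (hLG : ∀ w, ‖gradient L w‖ ≤ G)
    (hLH : ∀ w, ‖hessian L w‖ ≤ H)
    (i : Fin N)
    (hSC : ∀ (t : ℝ), t ∈ Set.Icc (0 : ℝ) 1 →
      ∀ w v : EuclideanSpace ℝ (Fin d),
        α * ‖v‖ ^ 2 ≤ ⟪hessian (FSt l Reg lam i t) w v, v⟫)
    (w w' w'' : ℝ → EuclideanSpace ℝ (Fin d))
    (hw : ∀ t ∈ Set.Icc (0 : ℝ) 1, HasDerivWithinAt w (w' t) (Set.Icc (0 : ℝ) 1) t)
    (hw' : ∀ t ∈ Set.Icc (0 : ℝ) 1, HasDerivWithinAt w' (w'' t) (Set.Icc (0 : ℝ) 1) t)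
    (hopt : ∀ t ∈ Set.Icc (0 : ℝ) 1, gradient (FSt l Reg lam i t) (w t) = 0) :
    hessian (FS l Reg lam) (w 0) (w' 0) = gradient (l i) (w 0) ∧
    L (w 1) ≤ L (w 0) + ⟪gradient L (w 0), w' 0⟫
      + (3 * H * G ^ 2 / α ^ 2 + ((N : ℝ) * β + lam * βR) * G ^ 3 / α ^ 3) / 2 := by
  set B := (N : ℝ) * β + lam * βR with hB
  have hFS := aux_FS_contDiff l Reg lam hl hReg
  have ud : ∀ t ∈ Set.Icc (0 : ℝ) 1, UniqueDiffWithinAt ℝ (Set.Icc (0 : ℝ) 1) t :=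
    uniqueDiffOn_Icc zero_lt_one
  have hG0 : 0 ≤ G := (norm_nonneg _).trans (hlG i 0)
  have hH0 : 0 ≤ H := (norm_nonneg _).trans (hlH i 0)
  have hB0 : 0 ≤ B := by
    have h := aux_lip l Reg lam β βR hlam hl hReg hlLip hRegLip i 0 (by simp)
      (EuclideanSpace.single ⟨0, hd⟩ 1) 0
    have h2 := (norm_nonneg _).trans h
    simpa using h2
  -- derivatives of gradients
  have dgl : ∀ x, HasFDerivAt (gradient (l i)) (hessian (l i) x) x := fun x =>
    ((aux_grad_contDiff (m := 1) (n := 3) (hl i) (by norm_num)).differentiable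
      (by norm_num) x).hasFDerivAt
  have dgF : ∀ x, HasFDerivAt (gradient (FS l Reg lam)) (hessian (FS l Reg lam) x) x := fun x =>
    ((aux_grad_contDiff (m := 1) (n := 3) hFS (by norm_num)).differentiable
      (by norm_num) x).hasFDerivAt
  have dgL : ∀ x, HasFDerivAt (gradient L) (hessian L x) x := fun x =>
    ((aux_grad_contDiff (m := 1) (n := 2) hL (by norm_num)).differentiable
      (by norm_num) x).hasFDerivAt
  have dL : ∀ x, HasFDerivAt L (fderiv ℝ L x) x := fun x =>
    (hL.differentiable (by norm_num) x).hasFDerivAt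
  have dHl : ∀ x, HasFDerivAt (hessian (l i)) (fderiv ℝ (hessian (l i)) x) x := fun x =>
    ((aux_hess_contDiff (m := 1) (n := 3) (hl i) (by norm_num)).differentiable
      (by norm_num) x).hasFDerivAt
  have dHF : ∀ x, HasFDerivAt (hessian (FS l Reg lam)) (fderiv ℝ (hessian (FS l Reg lam)) x) x :=
    fun x => ((aux_hess_contDiff (m := 1) (n := 3) hFS (by norm_num)).differentiable
      (by norm_num) x).hasFDerivAt
  -- first-order identity
  have E1 : ∀ t ∈ Set.Icc (0 : ℝ) 1,
      (hessian (FS l Reg lam) (w t) - t • hessian (l i) (w t)) (w' t) = gradient (l i) (w t) := by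
    intro t ht
    have h1 := (dgF (w t)).comp_hasDerivWithinAt t (hw t ht)
    have h2 := (dgl (w t)).comp_hasDerivWithinAt t (hw t ht)
    have h3 := h1.fun_sub ((hasDerivWithinAt_id t _).fun_smul h2)
    have h4 : HasDerivWithinAt (fun _ : ℝ => (0 : EuclideanSpace ℝ (Fin d))) 0
      (Set.Icc (0 : ℝ) 1) t := hasDerivWithinAt_const _ _ _
    have h5 := h4.congr_of_mem (f₁ := fun s => gradient (FS l Reg lam) (w s) - s • gradient (l i) (w s))
      (fun s hs => by
        have := hopt s hs
        rw [aux_grad_FSt l Reg lam hl hReg] at this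
        exact this) ht
    have h6 := (ud t ht).eq_deriv _ h3 h5
    simp only [id, one_smul, Function.comp] at h6
    simp only [ContinuousLinearMap.sub_apply, ContinuousLinearMap.smul_apply]
    rw [← sub_eq_zero, ← h6]
    abel
  have Kn : ∀ t ∈ Set.Icc (0 : ℝ) 1, ∀ v, α * ‖v‖ ≤
      ‖(hessian (FS l Reg lam) (w t) - t • hessian (l i) (w t)) v‖ := by
    intro t ht
    refine aux_coer _ α (fun v => ?_)
    have := hSC t ht (w t) v
    rwa [aux_hess_FSt l Reg lam hl hReg] at this
  have N1 : ∀ t ∈ Set.Icc (0 : ℝ) 1, ‖w' t‖ ≤ G / α := by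
    intro t ht
    rw [le_div_iff₀ hα, mul_comm]
    refine (Kn t ht _).trans ?_
    rw [E1 t ht]
    exact hlG i _
  have N2 : ∀ t ∈ Set.Icc (0 : ℝ) 1, ‖w'' t‖ ≤ (2 * H * (G / α) + B * (G / α) ^ 2) / α := by
    intro t ht
    set T := fderiv ℝ (hessian (FS l Reg lam)) (w t) - t • fderiv ℝ (hessian (l i)) (w t) with hT
    have hTn : ‖T‖ ≤ B := by
      have hd : HasFDerivAt (hessian (FSt l Reg lam i t)) T (w t) := by
        rw [aux_hess_FSt l Reg lam hl hReg]
        exact (dHF (w t)).sub ((dHl (w t)).const_smul t)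
      have hlip : LipschitzWith ⟨B, hB0⟩ (hessian (FSt l Reg lam i t)) := by
        refine LipschitzWith.of_dist_le_mul (fun x y => ?_)
        rw [dist_eq_norm, dist_eq_norm]
        exact aux_lip l Reg lam β βR hlam hl hReg hlLip hRegLip i t ht x y
      exact hd.le_of_lipschitz hlip
    have k1 := (dHF (w t)).comp_hasDerivWithinAt t (hw t ht)
    have k2 := (dHl (w t)).comp_hasDerivWithinAt t (hw t ht)
    have k3 := k1.fun_sub ((hasDerivWithinAt_id t _).fun_smul k2)
    have k4 := k3.clm_apply (hw' t ht)
    have k5 := (dgl (w t)).comp_hasDerivWithinAt t (hw t ht)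
    have k6 := k5.congr_of_mem (f₁ := fun y => (hessian (FS l Reg lam) (w y)
        - y • hessian (l i) (w y)) (w' y)) (fun s hs => by
      exact E1 s hs) ht
    have k7 := (ud t ht).eq_deriv _ k4 k6
    have k8 : (hessian (FS l Reg lam) (w t) - t • hessian (l i) (w t)) (w'' t)
        = (2 : ℝ) • hessian (l i) (w t) (w' t) - (T (w' t)) (w' t) := by
      simp only [id, one_smul, Function.comp, ContinuousLinearMap.sub_apply,
        ContinuousLinearMap.smul_apply, ContinuousLinearMap.add_apply, Pi.sub_apply,
        Pi.smul_apply', hT] at k7 ⊢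
      rw [two_smul]
      nth_rewrite 1 [← k7]
      abel
    rw [le_div_iff₀ hα, mul_comm]
    refine (Kn t ht _).trans ?_
    rw [k8]
    have hn := N1 t ht
    have b1 : ‖(2 : ℝ) • hessian (l i) (w t) (w' t)‖ ≤ 2 * H * (G / α) := by
      rw [norm_smul, Real.norm_of_nonneg (by norm_num), mul_assoc]
      gcongr
      exact ((hessian (l i) (w t)).le_opNorm _).trans
        (mul_le_mul (hlH i _) hn (norm_nonneg _) hH0)
    have b2 : ‖(T (w' t)) (w' t)‖ ≤ B * (G / α) ^ 2 := by
      refine (T.le_opNorm₂ _ _).trans ?_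
      rw [mul_assoc, sq]
      gcongr
    exact (norm_sub_le _ _).trans (add_le_add b1 b2)
  refine ⟨by simpa using E1 0 (by simp), ?_⟩
  refine aux_taylor (fun t => L (w t)) (fun t => ⟪gradient L (w t), w' t⟫)
    (fun t => ⟪gradient L (w t), w'' t⟫ + ⟪hessian L (w t) (w' t), w' t⟫) _ ?_ ?_ ?_
  · intro t ht
    have h := (dL (w t)).comp_hasDerivWithinAt t (hw t ht)
    refine h.congr_deriv ?_
    simp [gradient]
  · intro t ht
    exact ((dgL (w t)).comp_hasDerivWithinAt t (hw t ht)).inner ℝ (hw' t ht)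
  · intro t ht
    have n1 := N1 t ht
    have n2 := N2 t ht
    have c1 : ⟪gradient L (w t), w'' t⟫ ≤ G * ((2 * H * (G / α) + B * (G / α) ^ 2) / α) :=
      (real_inner_le_norm _ _).trans (mul_le_mul (hLG _) n2 (norm_nonneg _) hG0)
    have c2 : ⟪hessian L (w t) (w' t), w' t⟫ ≤ H * (G / α) * (G / α) := by
      refine (real_inner_le_norm _ _).trans ?_
      refine mul_le_mul ?_ n1 (norm_nonneg _) (by positivity)
      exact ((hessian L (w t)).le_opNorm _).trans (mul_le_mul (hLH _) n1 (norm_nonneg _) hH0)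
    refine (add_le_add c1 c2).trans (le_of_eq ?_)
    field_simp
    ring

/-- Beneficial deletion: if `λ·D > C·N/2` with
`D = ⟨∇L(ŵ), H₀⁻¹(−(1/λ)·∑ᵢ ∇ℓᵢ(ŵ))⟩`, `C = 3HG²/α² + β̄G³/α³`, `β̄ = N·β + λ·β_R`,
then deleting a uniformly chosen training example strictly decreases the expected test loss:
`(1/N)·∑ᵢ L(ŵ₋ᵢ) < L(ŵ)`. -/
theorem stmt8 {d N : ℕ} (hd : 1 ≤ d) (hN : 1 ≤ N)
    (l : Fin N → EuclideanSpace ℝ (Fin d) → ℝ)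
    (Reg : EuclideanSpace ℝ (Fin d) → ℝ)
    (L : EuclideanSpace ℝ (Fin d) → ℝ)
    (lam G H β βR α : ℝ) (hlam : 0 < lam) (hα : 0 < α)
    -- (A1) smooth losses (C³)
    (hl : ∀ i, ContDiff ℝ 3 (l i))
    (hlG : ∀ i w, ‖gradient (l i) w‖ ≤ G)
    (hlH : ∀ i w, ‖hessian (l i) w‖ ≤ H)
    (hlLip : ∀ i w v, ‖hessian (l i) w - hessian (l i) v‖ ≤ β * ‖w - v‖)
    -- (A2) smooth regularizer (C³)
    (hReg : ContDiff ℝ 3 Reg)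
    (hRegLip : ∀ w v, ‖hessian Reg w - hessian Reg v‖ ≤ βR * ‖w - v‖)
    -- (A3) strong convexity of every F_{S,t,i}
    (hSC : ∀ (i : Fin N) (t : ℝ), t ∈ Set.Icc (0 : ℝ) 1 →
      ∀ w v : EuclideanSpace ℝ (Fin d),
        α * ‖v‖ ^ 2 ≤ ⟪hessian (FSt l Reg lam i t) w v, v⟫)
    -- test risk is C² with bounded gradient and Hessian
    (hL : ContDiff ℝ 2 L)
    (hLG : ∀ w, ‖gradient L w‖ ≤ G)
    (hLH : ∀ w, ‖hessian L w‖ ≤ H)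
    -- minimizers and the connecting curves
    (what : EuclideanSpace ℝ (Fin d))
    (hmin : ∀ v, FS l Reg lam what ≤ FS l Reg lam v)
    (wmin : Fin N → EuclideanSpace ℝ (Fin d))
    (hmin' : ∀ i v, FSt l Reg lam i 1 (wmin i) ≤ FSt l Reg lam i 1 v)
    (w : Fin N → ℝ → EuclideanSpace ℝ (Fin d))
    (w' : Fin N → ℝ → EuclideanSpace ℝ (Fin d))
    (w'' : Fin N → ℝ → EuclideanSpace ℝ (Fin d))
    (hw : ∀ i, ∀ t ∈ Set.Icc (0 : ℝ) 1,
      HasDerivWithinAt (w i) (w' i t) (Set.Icc (0 : ℝ) 1) t)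
    (hw' : ∀ i, ∀ t ∈ Set.Icc (0 : ℝ) 1,
      HasDerivWithinAt (w' i) (w'' i t) (Set.Icc (0 : ℝ) 1) t)
    (hw'' : ∀ i, ContinuousOn (w'' i) (Set.Icc (0 : ℝ) 1))
    (hopt : ∀ i, ∀ t ∈ Set.Icc (0 : ℝ) 1, gradient (FSt l Reg lam i t) (w i t) = 0)
    (hw0 : ∀ i, w i 0 = what)
    (hw1 : ∀ i, w i 1 = wmin i)
    -- the beneficial-deletion condition λ·D > C·N/2
    (hcond : lam *
        ⟪gradient L what,
          Ring.inverse (hessian (FS l Reg lam) what)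
            ((-(1 / lam)) • ∑ i : Fin N, gradient (l i) what)⟫
      > (3 * H * G ^ 2 / α ^ 2 + ((N : ℝ) * β + lam * βR) * G ^ 3 / α ^ 3) * N / 2) :
    (1 / (N : ℝ)) * ∑ i : Fin N, L (wmin i) < L what := by

  have hc := fun i => aux_curve hd l Reg L lam G H β βR α hlam hα hl hlG hlH hlLip hReg hRegLip
    hL hLG hLH i (hSC i) (w i) (w' i) (w'' i) (hw i) (hw' i) (hopt i)
  set C := 3 * H * G ^ 2 / α ^ 2 + ((N : ℝ) * β + lam * βR) * G ^ 3 / α ^ 3 with hC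
  simp only [hw0, hw1] at hc
  have i0 : Fin N := ⟨0, hN⟩
  have hu : IsUnit (hessian (FS l Reg lam) what) := by
    refine aux_unit _ α hα (aux_coer _ α (fun v => ?_))
    have := hSC i0 0 (by simp) what v
    rw [aux_hess_FSt l Reg lam hl hReg] at this
    simpa using this
  have hinv : ∀ i, Ring.inverse (hessian (FS l Reg lam) what) (gradient (l i) what) = w' i 0 := by
    intro i
    rw [← (hc i).1, ← mul_apply_eq_comp, Ring.inverse_mul_cancel _ hu]
    rfl
  rw [map_smul, map_sum, Finset.sum_congr rfl (fun i _ => hinv i), inner_smul_right,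
    inner_sum] at hcond
  have hsum := Finset.sum_le_sum (fun i (_ : i ∈ (Finset.univ : Finset (Fin N))) => (hc i).2)
  rw [Finset.sum_add_distrib, Finset.sum_add_distrib] at hsum
  simp only [Finset.sum_const, Finset.card_univ, Fintype.card_fin, nsmul_eq_mul] at hsum
  have e : ∀ S : ℝ, lam * (-(1 / lam) * S) = -S := fun S => by field_simp
  rw [e] at hcond
  have hNp : (0 : ℝ) < N := by exact_mod_cast hN
  rw [one_div, inv_mul_lt_iff₀ hNp]
  linarith
end
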